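/- For all real z > 0 and x > 0, 2 ∫_0^∞ ( ψ(tz + 1) - log(tz) ) cos(2πxt) dt = (1/z) ( ψ(x/z + 1) - log(x/z) ). -/

import Mathlib

open Real MeasureTheory Filter intervalIntegral

/-- The digamma function `ψ = Γ'/Γ`. -/
noncomputable def digamma (x : ℝ) : ℝ := deriv Real.Gamma x / Real.Gamma x

open Set Topology

lemma deriv_Gamma_add_one_of_pos {s : ℝ} (hs : 0 < s) :
    deriv Real.Gamma (s + 1) = Real.Gamma s + s * deriv Real.Gamma s := by
  have hd : DifferentiableAt ℝ Real.Gamma s :=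
    differentiableAt_Gamma fun m => by have : (0 : ℝ) ≤ m := m.cast_nonneg; linarith
  rw [← deriv_comp_add_const]
  have h := (hasDerivAt_id s).mul hd.hasDerivAt
  rw [Filter.EventuallyEq.deriv_eq (f := fun t => t * Real.Gamma t)]
  · simpa using! h.deriv
  · filter_upwards [lt_mem_nhds hs] with t ht using Real.Gamma_add_one ht.ne'

lemma digamma_add_one {s : ℝ} (hs : 0 < s) : digamma (s + 1) = digamma s + 1 / s := by
  have hG := (Real.Gamma_pos_of_pos hs).ne'
  rw [digamma, digamma, deriv_Gamma_add_one_of_pos hs, Real.Gamma_add_one hs.ne']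
  field_simp
  ring

lemma hasDerivAt_log_Gamma {s : ℝ} (hs : 0 < s) :
    HasDerivAt (Real.log ∘ Real.Gamma) (digamma s) s := by
  have hd : DifferentiableAt ℝ Real.Gamma s :=
    differentiableAt_Gamma fun m => by have : (0 : ℝ) ≤ m := m.cast_nonneg; linarith
  exact hd.hasDerivAt.log (Real.Gamma_pos_of_pos hs).ne'

lemma slope_log_Gamma {s : ℝ} (hs : 0 < s) :
    slope (Real.log ∘ Real.Gamma) s (s + 1) = Real.log s := by
  rw [slope_def_field, Function.comp, Function.comp, Real.Gamma_add_one hs.ne',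
    Real.log_mul hs.ne' (Real.Gamma_pos_of_pos hs).ne']
  ring

lemma digamma_le_log {s : ℝ} (hs : 0 < s) : digamma s ≤ Real.log s := by
  rw [← slope_log_Gamma hs]
  exact Real.convexOn_log_Gamma.le_slope_of_hasDerivAt hs (hs.trans (lt_add_one s))
    (lt_add_one s) (hasDerivAt_log_Gamma hs)

lemma log_le_digamma_add_one {s : ℝ} (hs : 0 < s) : Real.log s ≤ digamma (s + 1) := by
  rw [← slope_log_Gamma hs]
  have hs' : 0 < s + 1 := by linarith
  exact Real.convexOn_log_Gamma.slope_le_of_hasDerivAt hs hs' (lt_add_one s)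
    (hasDerivAt_log_Gamma hs')

/-- The function `ψ(s + 1) - log s` is characterised on `(0, ∞)` by its difference equation and
its decay at infinity. -/
lemma eq_digamma_add_one_sub_log {F : ℝ → ℝ}
    (hF : ∀ s, 0 < s → F s - F (s + 1) = Real.log ((s + 1) / s) - 1 / (s + 1))
    (hlim : Tendsto F atTop (𝓝 0)) {s : ℝ} (hs : 0 < s) :
    F s = digamma (s + 1) - Real.log s := by
  set D : ℝ → ℝ := fun s => F s - (digamma (s + 1) - Real.log s) with hD
  have hper (t : ℝ) (ht : 0 < t) : D (t + 1) = D t := by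
    have h1 := hF t ht
    have ht' : 0 < t + 1 := by linarith
    rw [Real.log_div ht'.ne' ht.ne'] at h1
    have h2 := digamma_add_one ht'
    simp only [hD]
    linarith
  have hnat (n : ℕ) : D (s + n) = D s := by
    induction n with
    | zero => simp
    | succ n ih =>
      rw [Nat.cast_succ, ← add_assoc, hper _ (by positivity), ih]
  have hpsi : Tendsto (fun s => digamma (s + 1) - Real.log s) atTop (𝓝 0) := by
    have h : Tendsto (fun s : ℝ => 1 / s) atTop (𝓝 0) := by
      simpa using tendsto_inv_atTop_zero (𝕜 := ℝ)
    refine tendsto_of_tendsto_of_tendsto_of_le_of_le' tendsto_const_nhds h ?_ ?_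
    · filter_upwards [eventually_gt_atTop 0] with t ht
      linarith [log_le_digamma_add_one ht]
    · filter_upwards [eventually_gt_atTop 0] with t ht
      linarith [digamma_le_log ht, digamma_add_one ht]
  have hDlim : Tendsto D atTop (𝓝 0) := by simpa using hlim.sub hpsi
  have h1 : Tendsto (fun n : ℕ => D (s + n)) atTop (𝓝 0) :=
    hDlim.comp (tendsto_atTop_add_const_left _ _ tendsto_natCast_atTop_atTop)
  have h2 : D s = 0 := tendsto_nhds_unique (tendsto_const_nhds.congr fun n => (hnat n).symm) h1
  exact sub_eq_zero.mp h2

/-- The kernel of the Laplace transform representing `ψ(s + 1) - log s`. -/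
noncomputable def digammaKernel (u : ℝ) : ℝ := 1 / u - 1 / (Real.exp u - 1)

lemma digammaKernel_nonneg {u : ℝ} (hu : 0 < u) : 0 ≤ digammaKernel u := by
  rw [digammaKernel, sub_nonneg]
  exact one_div_le_one_div_of_le hu (by linarith [Real.add_one_le_exp u])

lemma digammaKernel_le_one_div {u : ℝ} (hu : 0 < u) : digammaKernel u ≤ 1 / u := by
  rw [digammaKernel, sub_le_self_iff]
  exact one_div_nonneg.mpr (by linarith [Real.add_one_le_exp u])

lemma digammaKernel_le_one {u : ℝ} (hu : 0 < u) : digammaKernel u ≤ 1 := by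
  have h1 : 0 < Real.exp u - 1 := by linarith [Real.add_one_lt_exp hu.ne']
  have h2 : Real.exp u * (-u + 1) ≤ 1 := by
    calc Real.exp u * (-u + 1) ≤ Real.exp u * Real.exp (-u) := by
          gcongr; exact Real.add_one_le_exp _
      _ = 1 := by rw [← Real.exp_add]; simp
  rw [digammaKernel, div_sub_div _ _ hu.ne' h1.ne', div_le_one (by positivity)]
  linarith

lemma mul_digammaKernel_le_one {u : ℝ} (hu : 0 < u) : u * digammaKernel u ≤ 1 := by
  calc u * digammaKernel u ≤ u * (1 / u) := by gcongr; exact digammaKernel_le_one_div hu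
    _ = 1 := by field_simp

@[fun_prop]
lemma measurable_digammaKernel : Measurable digammaKernel := by
  unfold digammaKernel
  fun_prop

lemma integrableOn_exp_neg_mul {s : ℝ} (hs : 0 < s) :
    IntegrableOn (fun u : ℝ => Real.exp (-(s * u))) (Ioi 0) := by
  simpa [neg_mul] using integrableOn_exp_mul_Ioi (neg_lt_zero.mpr hs) 0

lemma integral_exp_neg_mul {s : ℝ} (hs : 0 < s) :
    ∫ u in Ioi (0 : ℝ), Real.exp (-(s * u)) = 1 / s := by
  have := integral_exp_mul_Ioi (neg_lt_zero.mpr hs) 0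
  simpa [neg_mul] using this

lemma integrableOn_digammaKernel_mul_exp {s : ℝ} (hs : 0 < s) :
    IntegrableOn (fun u => digammaKernel u * Real.exp (-(s * u))) (Ioi 0) := by
  refine (integrableOn_exp_neg_mul hs).mono' (by fun_prop) ?_
  filter_upwards [ae_restrict_mem measurableSet_Ioi] with u hu
  rw [norm_mul, Real.norm_of_nonneg (digammaKernel_nonneg hu), Real.norm_of_nonneg (by positivity)]
  exact mul_le_of_le_one_left (by positivity) (digammaKernel_le_one hu)

lemma integral_frullani_exp {s : ℝ} (hs : 0 < s)
    (hint : IntegrableOn (fun u : ℝ => u⁻¹ * (Real.exp (-(s * u)) - Real.exp (-((s + 1) * u))))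
      (Ioi 0)) :
    ∫ u in Ioi (0 : ℝ), u⁻¹ * (Real.exp (-(s * u)) - Real.exp (-((s + 1) * u))) =
      Real.log ((s + 1) / s) := by
  have hc : Continuous fun x : ℝ => Real.exp (-x) := by fun_prop
  have h := Frullani.integral_Ioi_eq (f := fun x : ℝ => Real.exp (-x)) (L := 1) (R := 0)
    (a := s) (b := s + 1) (hc.locallyIntegrable.locallyIntegrableOn _) hs (by linarith)
    ((hc.tendsto' 0 1 (by simp)).mono_left nhdsWithin_le_nhds)
    Real.tendsto_exp_neg_atTop_nhds_zero (by simpa using hint)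
  simpa using h

/-- Laplace transform representation of `ψ(s + 1) - log s`. -/
lemma integral_digammaKernel_mul_exp {s : ℝ} (hs : 0 < s) :
    ∫ u in Ioi (0 : ℝ), digammaKernel u * Real.exp (-(s * u)) =
      digamma (s + 1) - Real.log s := by
  refine eq_digamma_add_one_sub_log
    (F := fun s => ∫ u in Ioi (0 : ℝ), digammaKernel u * Real.exp (-(s * u)))
    (fun s hs => ?_) ?_ hs
  · have hs' : 0 < s + 1 := by linarith
    have h1 := integrableOn_digammaKernel_mul_exp hs
    have h2 := integrableOn_digammaKernel_mul_exp hs'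
    have h3 := integrableOn_exp_neg_mul hs'
    have heq (u : ℝ) (hu : u ∈ Ioi (0 : ℝ)) :
        u⁻¹ * (Real.exp (-(s * u)) - Real.exp (-((s + 1) * u))) =
        (digammaKernel u * Real.exp (-(s * u)) - digammaKernel u * Real.exp (-((s + 1) * u))) +
          Real.exp (-((s + 1) * u)) := by
      have hu0 : 0 < u := hu
      have hE : 0 < Real.exp u - 1 := by linarith [Real.add_one_lt_exp hu0.ne']
      have hexp : Real.exp (-(s * u)) = Real.exp u * Real.exp (-((s + 1) * u)) := by
        rw [← Real.exp_add]; ring_nf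
      rw [hexp, digammaKernel]
      field_simp
      ring
    have hint : IntegrableOn
        (fun u : ℝ => u⁻¹ * (Real.exp (-(s * u)) - Real.exp (-((s + 1) * u)))) (Ioi 0) :=
      IntegrableOn.congr_fun ((h1.sub h2).add h3) (fun u hu => (heq u hu).symm) measurableSet_Ioi
    have hfr := integral_frullani_exp hs hint
    rw [setIntegral_congr_fun measurableSet_Ioi heq, integral_add (by exact h1.sub h2) h3,
      integral_sub h1 h2, integral_exp_neg_mul hs'] at hfr
    linarith
  · have h : Tendsto (fun s : ℝ => 1 / s) atTop (𝓝 0) := by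
      simpa using tendsto_inv_atTop_zero (𝕜 := ℝ)
    refine tendsto_of_tendsto_of_tendsto_of_le_of_le' tendsto_const_nhds h ?_ ?_
    · filter_upwards with t
      exact setIntegral_nonneg measurableSet_Ioi fun u hu =>
        mul_nonneg (digammaKernel_nonneg hu) (by positivity)
    · filter_upwards [eventually_gt_atTop 0] with t ht
      rw [← integral_exp_neg_mul ht]
      exact setIntegral_mono_on (integrableOn_digammaKernel_mul_exp ht)
        (integrableOn_exp_neg_mul ht) measurableSet_Ioi fun u hu =>
        mul_le_of_le_one_left (by positivity) (digammaKernel_le_one hu)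

/-- Partial fraction expansion of the kernel. -/
lemma hasSum_digammaKernel {u : ℝ} (hu : 0 < u) :
    HasSum (fun n : ℕ => 2 * u / (u ^ 2 + (2 * π * (n + 1)) ^ 2)) (1 / 2 - digammaKernel u) := by
  have hpi : (π : ℂ) ≠ 0 := Complex.ofReal_ne_zero.mpr pi_ne_zero
  set x : ℂ := Complex.I * u / (2 * π) with hx
  have him : x.im = u / (2 * π) := by
    have : x = ((u / (2 * π) : ℝ) : ℂ) * Complex.I := by
      rw [hx]; push_cast; ring
    rw [this, Complex.im_ofReal_mul, Complex.I_im, mul_one]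
  have hxZ : x ∈ Complex.integerComplement := by
    rintro ⟨n, hn⟩
    have : x.im = 0 := by rw [← hn]; simp
    rw [him] at this
    have : 0 < u / (2 * π) := by positivity
    linarith
  have hsum : HasSum (fun n => cotTerm x n) (π * Complex.cot (π * x) - 1 / x) :=
    (summable_cotTerm hxZ).hasSum_iff_tendsto_nat.mpr (tendsto_logDeriv_euler_cot_sub hxZ)
  have hsum := hsum.mul_left (Complex.I / (2 * π))
  have hterm (n : ℕ) : Complex.I / (2 * π) * cotTerm x n =
      ((2 * u / (u ^ 2 + (2 * π * (n + 1)) ^ 2) : ℝ) : ℂ) := by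
    have hden : ((u : ℂ) ^ 2 + (2 * π * (n + 1)) ^ 2) ≠ 0 := by
      have : u ^ 2 + (2 * π * (n + 1)) ^ 2 ≠ 0 := by positivity
      exact_mod_cast this
    have hxu : (2 * π) * x = Complex.I * u := by rw [hx]; field_simp
    have hfac : ((u : ℂ) ^ 2 + (2 * π * (n + 1)) ^ 2) =
        -(2 * π) ^ 2 * ((x + (n + 1)) * (x - (n + 1))) := by
      linear_combination (2 * π * x + Complex.I * u) * hxu + (u : ℂ) ^ 2 * Complex.I_sq
    have hxe : (u : ℂ) = -Complex.I * (2 * π * x) := by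
      linear_combination Complex.I * hxu + (u : ℂ) * Complex.I_sq
    rw [cotTerm_identity hxZ]
    push_cast
    rw [hfac] at hden ⊢
    have h0 : (x + (n + 1)) * (x - (n + 1)) ≠ 0 := right_ne_zero_of_mul hden
    rw [hxe]
    field_simp
  have hval : Complex.I / (2 * π) * (π * Complex.cot (π * x) - 1 / x) =
      ((1 / 2 - digammaKernel u : ℝ) : ℂ) := by
    have hE : Complex.exp (2 * π * Complex.I * x) = ((Real.exp u)⁻¹ : ℝ) := by
      rw [← Real.exp_neg, Complex.ofReal_exp, hx]
      congr 1
      push_cast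
      field_simp
      simp
    have he : (Real.exp u : ℂ) ≠ 0 := Complex.ofReal_ne_zero.mpr (Real.exp_pos u).ne'
    have he1 : (Real.exp u : ℂ) - 1 ≠ 0 := by
      have : Real.exp u - 1 ≠ 0 := by linarith [Real.add_one_lt_exp hu.ne']
      exact_mod_cast this
    rw [Complex.cot_pi_eq_exp_ratio, hE, digammaKernel, hx]
    push_cast
    rw [← Complex.ofReal_exp]
    generalize (Real.exp u : ℂ) = E at *
    have he2 : 1 - E⁻¹ = (E - 1) * E⁻¹ := by field_simp
    rw [he2]
    field_simp
    ring
  simp_rw [hterm, hval] at hsum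
  exact Complex.hasSum_ofReal.mp hsum

lemma hasDerivAt_sq_add (c u : ℝ) : HasDerivAt (fun u : ℝ => u ^ 2 + c) (2 * u) u := by
  simpa using (hasDerivAt_pow 2 u).add_const c

lemma tendsto_arctan_div_atTop {a : ℝ} (ha : 0 < a) :
    Tendsto (fun u : ℝ => Real.arctan (u / a)) atTop (𝓝 (π / 2)) :=
  (tendsto_arctan_atTop.mono_right nhdsWithin_le_nhds).comp (tendsto_id.atTop_div_const ha)

lemma hasDerivAt_arctan_div {a : ℝ} (ha : 0 < a) (u : ℝ) :
    HasDerivAt (fun u : ℝ => Real.arctan (u / a)) (a / (u ^ 2 + a ^ 2)) u := by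
  refine ((hasDerivAt_id' u).div_const a).arctan.congr_deriv ?_
  field_simp
  ring

lemma integrableOn_one_div_sq_add_sq {a : ℝ} (ha : 0 < a) :
    IntegrableOn (fun u : ℝ => 1 / (u ^ 2 + a ^ 2)) (Ioi 0) := by
  refine integrableOn_Ioi_deriv_of_nonneg' (g := fun u => Real.arctan (u / a) / a)
    (fun u _ => ?_) (fun u _ => by positivity) ((tendsto_arctan_div_atTop ha).div_const a)
  refine ((hasDerivAt_arctan_div ha u).div_const a).congr_deriv ?_
  field_simp

lemma integral_one_div_sq_add_sq {a : ℝ} (ha : 0 < a) :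
    ∫ u in Ioi (0 : ℝ), 1 / (u ^ 2 + a ^ 2) = π / 2 / a := by
  have := integral_Ioi_of_hasDerivAt_of_tendsto' (f := fun u => Real.arctan (u / a) / a)
    (f' := fun u => 1 / (u ^ 2 + a ^ 2)) (a := 0)
    (fun u _ => ?_) (integrableOn_one_div_sq_add_sq ha) ((tendsto_arctan_div_atTop ha).div_const a)
  · simpa using this
  · refine ((hasDerivAt_arctan_div ha u).div_const a).congr_deriv ?_
    field_simp

lemma integrableOn_sq_div_mul {a b : ℝ} (ha : 0 < a) (hb : 0 < b) :
    IntegrableOn (fun u : ℝ => u ^ 2 / ((u ^ 2 + a ^ 2) * (u ^ 2 + b ^ 2))) (Ioi 0) := by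
  refine (integrableOn_one_div_sq_add_sq ha).mono'
    (Measurable.aestronglyMeasurable (by fun_prop)) (ae_of_all _ fun u => ?_)
  rw [Real.norm_of_nonneg (by positivity), div_le_div_iff₀ (by positivity) (by positivity)]
  nlinarith [mul_pos (show 0 < u ^ 2 + a ^ 2 by positivity) (pow_pos hb 2)]

lemma integral_sq_div_mul {a b : ℝ} (ha : 0 < a) (hb : 0 < b) :
    ∫ u in Ioi (0 : ℝ), u ^ 2 / ((u ^ 2 + a ^ 2) * (u ^ 2 + b ^ 2)) = π / (2 * (a + b)) := by
  rcases eq_or_ne a b with rfl | hab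
  · have hlim : Tendsto (fun u : ℝ => u / (u ^ 2 + a ^ 2)) atTop (𝓝 0) := by
      refine tendsto_of_tendsto_of_tendsto_of_le_of_le' tendsto_const_nhds
        tendsto_inv_atTop_zero ?_ ?_
      · filter_upwards [eventually_gt_atTop 0] with u hu using by positivity
      · filter_upwards [eventually_gt_atTop 0] with u hu
        rw [← one_div, div_le_div_iff₀ (by positivity) hu]
        nlinarith [sq_nonneg a]
    have := integral_Ioi_of_hasDerivAt_of_tendsto'
      (f := fun u => Real.arctan (u / a) / (2 * a) - u / (u ^ 2 + a ^ 2) / 2)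
      (f' := fun u => u ^ 2 / ((u ^ 2 + a ^ 2) * (u ^ 2 + a ^ 2))) (a := 0)
      (fun u _ => ?_) (integrableOn_sq_div_mul ha ha)
      (((tendsto_arctan_div_atTop ha).div_const _).sub (hlim.div_const 2))
    · rw [this]
      simp
      field_simp
      ring
    · have h0 : u ^ 2 + a ^ 2 ≠ 0 := by positivity
      refine (((hasDerivAt_arctan_div ha u).div_const (2 * a)).sub
        (((hasDerivAt_id' u).div (hasDerivAt_sq_add (a ^ 2) u) h0).div_const 2)).congr_deriv ?_
      field_simp
      ring
  · have hsub : a ^ 2 - b ^ 2 ≠ 0 := by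
      rw [sq_sub_sq]
      exact mul_ne_zero (by positivity) (sub_ne_zero.mpr hab)
    have hab' : a - b ≠ 0 := sub_ne_zero.mpr hab
    have := integral_Ioi_of_hasDerivAt_of_tendsto'
      (f := fun u => (a * Real.arctan (u / a) - b * Real.arctan (u / b)) / (a ^ 2 - b ^ 2))
      (f' := fun u => u ^ 2 / ((u ^ 2 + a ^ 2) * (u ^ 2 + b ^ 2))) (a := 0)
      (fun u _ => ?_) (integrableOn_sq_div_mul ha hb)
      ((((tendsto_arctan_div_atTop ha).const_mul a).sub
        ((tendsto_arctan_div_atTop hb).const_mul b)).div_const _)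
    · rw [this]
      simp only [zero_div, Real.arctan_zero, mul_zero, sub_zero]
      rw [sq_sub_sq]
      field_simp
    · refine ((((hasDerivAt_arctan_div ha u).const_mul a).sub
        ((hasDerivAt_arctan_div hb u).const_mul b)).div_const (a ^ 2 - b ^ 2)).congr_deriv ?_
      field_simp
      ring

lemma hasDerivAt_log_sq_add_sq {a : ℝ} (ha : 0 < a) (u : ℝ) :
    HasDerivAt (fun u : ℝ => Real.log (u ^ 2 + a ^ 2) / 2) (u / (u ^ 2 + a ^ 2)) u := by
  have h0 : u ^ 2 + a ^ 2 ≠ 0 := by positivity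
  refine (((hasDerivAt_sq_add (a ^ 2) u).log h0).div_const 2).congr_deriv ?_
  field_simp

lemma div_sq_add_sq_sub_nonneg {a b u : ℝ} (ha : 0 < a) (hab : a ≤ b) (hu : 0 ≤ u) :
    0 ≤ u / (u ^ 2 + a ^ 2) - u / (u ^ 2 + b ^ 2) := by
  rw [sub_nonneg]
  gcongr

lemma tendsto_log_sq_add_sq_sub (a b : ℝ) :
    Tendsto (fun u : ℝ => Real.log (u ^ 2 + a ^ 2) / 2 - Real.log (u ^ 2 + b ^ 2) / 2)
      atTop (𝓝 0) := by
  have h2 : Tendsto (fun u : ℝ => u ^ 2) atTop atTop := tendsto_pow_atTop two_ne_zero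
  have hq (c : ℝ) : Tendsto (fun u : ℝ => 1 + c ^ 2 / u ^ 2) atTop (𝓝 1) := by
    simpa using (h2.const_div_atTop (c ^ 2)).const_add 1
  have hl (c : ℝ) : Tendsto (fun u : ℝ => Real.log (1 + c ^ 2 / u ^ 2) / 2) atTop (𝓝 0) := by
    simpa using ((hq c).log one_ne_zero).div_const 2
  have h := (hl a).sub (hl b)
  rw [sub_zero] at h
  refine h.congr' ?_
  filter_upwards [eventually_gt_atTop 0] with u hu
  have key (c : ℝ) : Real.log (u ^ 2 + c ^ 2) = Real.log (u ^ 2) + Real.log (1 + c ^ 2 / u ^ 2) := by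
    rw [← Real.log_mul (by positivity) (by positivity)]
    congr 1
    field_simp
  rw [key a, key b]
  ring

lemma integrableOn_div_sq_add_sq_sub {a b : ℝ} (ha : 0 < a) (hab : a ≤ b) :
    IntegrableOn (fun u : ℝ => u / (u ^ 2 + a ^ 2) - u / (u ^ 2 + b ^ 2)) (Ioi 0) :=
  integrableOn_Ioi_deriv_of_nonneg'
    (fun u _ => (hasDerivAt_log_sq_add_sq ha u).sub
      (hasDerivAt_log_sq_add_sq (ha.trans_le hab) u))
    (fun _ hu => div_sq_add_sq_sub_nonneg ha hab (le_of_lt hu))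
    (tendsto_log_sq_add_sq_sub a b)

lemma integral_div_sq_add_sq_sub {a b : ℝ} (ha : 0 < a) (hab : a ≤ b) :
    ∫ u in Ioi (0 : ℝ), (u / (u ^ 2 + a ^ 2) - u / (u ^ 2 + b ^ 2)) = Real.log (b / a) := by
  have hb := ha.trans_le hab
  rw [integral_Ioi_of_hasDerivAt_of_tendsto'
    (fun u _ => (hasDerivAt_log_sq_add_sq ha u).sub (hasDerivAt_log_sq_add_sq hb u))
    (integrableOn_div_sq_add_sq_sub ha hab) (tendsto_log_sq_add_sq_sub a b),
    Real.log_div hb.ne' ha.ne']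
  simp

lemma integrableOn_digammaKernel_mul_div {a : ℝ} (ha : 0 < a) :
    IntegrableOn (fun u : ℝ => digammaKernel u * (u / (u ^ 2 + a ^ 2))) (Ioi 0) := by
  refine (integrableOn_one_div_sq_add_sq ha).mono' (by fun_prop) ?_
  filter_upwards [ae_restrict_mem measurableSet_Ioi] with u hu
  have hu : 0 < u := hu
  rw [Real.norm_of_nonneg (mul_nonneg (digammaKernel_nonneg hu) (by positivity)), ← mul_div_assoc]
  gcongr
  linarith [mul_digammaKernel_le_one hu]

lemma hasSum_telescoping {s : ℝ} (hs : 0 < s) :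
    HasSum (fun n : ℕ => 1 / (n + s) - 1 / (n + 1 + s)) (1 / s) := by
  rw [hasSum_iff_tendsto_nat_of_nonneg]
  · have h (n : ℕ) : ∑ i ∈ Finset.range n, (1 / ((i : ℝ) + s) - 1 / (i + 1 + s)) =
        1 / s - 1 / (n + s) := by
      have := Finset.sum_range_sub' (fun i : ℕ => 1 / ((i : ℝ) + s)) n
      simpa using this
    simp_rw [h]
    have hlim : Tendsto (fun n : ℕ => 1 / ((n : ℝ) + s)) atTop (𝓝 0) :=
      (tendsto_atTop_add_const_right _ _ tendsto_natCast_atTop_atTop).const_div_atTop 1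
    simpa using hlim.const_sub (1 / s)
  · intro n
    rw [sub_nonneg]
    gcongr
    linarith

lemma integral_half_sub_digammaKernel_mul {s : ℝ} (hs : 0 < s) :
    ∫ u in Ioi (0 : ℝ), (1 / 2 - digammaKernel u) *
      (u / (u ^ 2 + (2 * π * s) ^ 2) - u / (u ^ 2 + (2 * π * (s + 1)) ^ 2)) =
      1 / (2 * (s + 1)) := by
  set a := 2 * π * s with ha_def
  set b := 2 * π * (s + 1) with hb_def
  have ha : 0 < a := by positivity
  have hb : 0 < b := by positivity
  have hab : a ≤ b := by rw [ha_def, hb_def]; gcongr; linarith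
  set p : ℕ → ℝ := fun n => 2 * π * (n + 1) with hp_def
  have hp (n : ℕ) : 0 < p n := by positivity
  set f : ℕ → ℝ → ℝ := fun n u => 2 * u / (u ^ 2 + p n ^ 2) *
    (u / (u ^ 2 + a ^ 2) - u / (u ^ 2 + b ^ 2)) with hf_def
  have hf (n : ℕ) (u : ℝ) : f n u = 2 * (u ^ 2 / ((u ^ 2 + p n ^ 2) * (u ^ 2 + a ^ 2)) -
      u ^ 2 / ((u ^ 2 + p n ^ 2) * (u ^ 2 + b ^ 2))) := by
    simp only [hf_def, mul_sub, div_mul_div_comm]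
    ring
  have hf_int (n : ℕ) : IntegrableOn (f n) (Ioi 0) := by
    simp_rw [funext (hf n)]
    exact ((integrableOn_sq_div_mul (hp n) ha).sub (integrableOn_sq_div_mul (hp n) hb)).const_mul 2
  have hf_val (n : ℕ) : ∫ u in Ioi (0 : ℝ), f n u =
      1 / 2 * (1 / (n + (s + 1)) - 1 / (n + 1 + (s + 1))) := by
    simp_rw [hf n]
    rw [MeasureTheory.integral_const_mul, integral_sub (integrableOn_sq_div_mul (hp n) ha)
      (integrableOn_sq_div_mul (hp n) hb), integral_sq_div_mul (hp n) ha,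
      integral_sq_div_mul (hp n) hb]
    simp only [hp_def, ha_def, hb_def]
    have h1 : 2 * π * ((n : ℝ) + 1) + 2 * π * s = 2 * π * (n + (s + 1)) := by ring
    have h2 : 2 * π * ((n : ℝ) + 1) + 2 * π * (s + 1) = 2 * π * (n + 1 + (s + 1)) := by ring
    rw [h1, h2]
    field_simp
  have hnorm (n : ℕ) : ∫ u in Ioi (0 : ℝ), ‖f n u‖ = ∫ u in Ioi (0 : ℝ), f n u := by
    refine setIntegral_congr_fun measurableSet_Ioi fun u hu => Real.norm_of_nonneg ?_
    have hu : 0 < u := hu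
    exact mul_nonneg (by positivity) (div_sq_add_sq_sub_nonneg ha hab hu.le)
  have htel := (hasSum_telescoping (s := s + 1) (by linarith)).mul_left (1 / 2)
  have hsum : HasSum (fun n => ∫ u in Ioi (0 : ℝ), f n u) (∫ u in Ioi (0 : ℝ), ∑' n, f n u) := by
    refine hasSum_integral_of_summable_integral_norm hf_int ?_
    simp_rw [hnorm, hf_val]
    exact htel.summable
  have htsum (u : ℝ) (hu : u ∈ Ioi (0 : ℝ)) : ∑' n, f n u = (1 / 2 - digammaKernel u) *
      (u / (u ^ 2 + a ^ 2) - u / (u ^ 2 + b ^ 2)) :=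
    ((hasSum_digammaKernel hu).mul_right _).tsum_eq
  simp_rw [hf_val] at hsum
  rw [setIntegral_congr_fun measurableSet_Ioi htsum] at hsum
  rw [hsum.unique htel]
  field_simp

/-- A form of Binet's second formula. -/
lemma integral_digammaKernel_mul_div {s : ℝ} (hs : 0 < s) :
    2 * ∫ u in Ioi (0 : ℝ), digammaKernel u * (u / (u ^ 2 + (2 * π * s) ^ 2)) =
      digamma (s + 1) - Real.log s := by
  refine eq_digamma_add_one_sub_log
    (F := fun s => 2 * ∫ u in Ioi (0 : ℝ), digammaKernel u * (u / (u ^ 2 + (2 * π * s) ^ 2)))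
    (fun s hs => ?_) ?_ hs
  · have hs' : 0 < s + 1 := by linarith
    have ha : 0 < 2 * π * s := by positivity
    have hb : 0 < 2 * π * (s + 1) := by positivity
    have hab : 2 * π * s ≤ 2 * π * (s + 1) := by gcongr; linarith
    have h1 := integrableOn_digammaKernel_mul_div ha
    have h2 := integrableOn_digammaKernel_mul_div hb
    have hK := (integrableOn_div_sq_add_sq_sub ha hab).const_mul (1 / 2)
    have h := integral_half_sub_digammaKernel_mul hs
    have heq (u : ℝ) : (1 / 2 - digammaKernel u) *
        (u / (u ^ 2 + (2 * π * s) ^ 2) - u / (u ^ 2 + (2 * π * (s + 1)) ^ 2)) =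
        1 / 2 * (u / (u ^ 2 + (2 * π * s) ^ 2) - u / (u ^ 2 + (2 * π * (s + 1)) ^ 2)) -
        (digammaKernel u * (u / (u ^ 2 + (2 * π * s) ^ 2)) -
          digammaKernel u * (u / (u ^ 2 + (2 * π * (s + 1)) ^ 2))) := by ring
    simp_rw [heq] at h
    rw [integral_sub hK (by exact h1.sub h2), integral_sub h1 h2, MeasureTheory.integral_const_mul,
      integral_div_sq_add_sq_sub ha hab, mul_div_mul_left _ _ (by positivity)] at h
    have h3 : 1 / (2 * (s + 1)) = 1 / 2 * (1 / (s + 1)) := by field_simp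
    linarith
  · have h : Tendsto (fun s : ℝ => 1 / 2 / s) atTop (𝓝 0) := tendsto_id.const_div_atTop _
    refine tendsto_of_tendsto_of_tendsto_of_le_of_le' tendsto_const_nhds h ?_ ?_
    · filter_upwards with t
      refine mul_nonneg zero_le_two (setIntegral_nonneg measurableSet_Ioi fun u hu => ?_)
      have hu : 0 < u := hu
      exact mul_nonneg (digammaKernel_nonneg hu) (by positivity)
    · filter_upwards [eventually_gt_atTop 0] with t ht
      have ha : 0 < 2 * π * t := by positivity
      calc 2 * ∫ u in Ioi (0 : ℝ), digammaKernel u * (u / (u ^ 2 + (2 * π * t) ^ 2))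
        _ ≤ 2 * ∫ u in Ioi (0 : ℝ), 1 / (u ^ 2 + (2 * π * t) ^ 2) := by
          gcongr 2 * ?_
          refine setIntegral_mono_on (integrableOn_digammaKernel_mul_div ha)
            (integrableOn_one_div_sq_add_sq ha) measurableSet_Ioi fun u hu => ?_
          have hu : 0 < u := hu
          rw [← mul_div_assoc]
          gcongr
          linarith [mul_digammaKernel_le_one hu]
        _ = 1 / 2 / t := by
          rw [integral_one_div_sq_add_sq ha]
          field_simp

lemma integral_exp_neg_mul_mul_cos {u a : ℝ} (hu : 0 < u) (T : ℝ) :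
    ∫ s in (0 : ℝ)..T, Real.exp (-(s * u)) * Real.cos (a * s) =
      (u + Real.exp (-(T * u)) * (a * Real.sin (a * T) - u * Real.cos (a * T))) /
        (u ^ 2 + a ^ 2) := by
  have hd (s : ℝ) : HasDerivAt
      (fun s => Real.exp (-(s * u)) * (a * Real.sin (a * s) - u * Real.cos (a * s)) /
        (u ^ 2 + a ^ 2)) (Real.exp (-(s * u)) * Real.cos (a * s)) s := by
    have ha : HasDerivAt (fun s : ℝ => a * s) a s := by
      simpa using (hasDerivAt_id' s).const_mul a
    have he : HasDerivAt (fun s : ℝ => -(s * u)) (-u) s := by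
      exact (((hasDerivAt_id' s).mul_const u).fun_neg).congr_deriv (by ring)
    refine ((he.exp.fun_mul ((ha.sin.const_mul a).fun_sub (ha.cos.const_mul u))).div_const
      (u ^ 2 + a ^ 2)).congr_deriv ?_
    field_simp
    ring
  rw [intervalIntegral.integral_eq_sub_of_hasDerivAt (fun s _ => hd s)
    (Continuous.intervalIntegrable (by fun_prop) _ _), ← sub_div]
  congr 1
  simp
  ring

lemma digammaKernel_mul_integral_exp_le {u T : ℝ} (hu : 0 < u) (hT : 0 ≤ T) :
    digammaKernel u * ∫ s in (0 : ℝ)..T, Real.exp (-(s * u)) ≤ (T + 1) / (u ^ 2 + 1 ^ 2) := by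
  have hI0 : 0 ≤ ∫ s in (0 : ℝ)..T, Real.exp (-(s * u)) :=
    intervalIntegral.integral_nonneg hT fun s _ => by positivity
  have hIT : ∫ s in (0 : ℝ)..T, Real.exp (-(s * u)) ≤ T := by
    have : ∫ s in (0 : ℝ)..T, Real.exp (-(s * u)) ≤ ∫ s in (0 : ℝ)..T, 1 := by
      refine intervalIntegral.integral_mono_on hT
        (Continuous.intervalIntegrable (by fun_prop) _ _)
        (Continuous.intervalIntegrable (by fun_prop) _ _) fun s hs => ?_
      rw [Real.exp_le_one_iff]
      linarith [mul_nonneg hs.1 hu.le]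
    simpa using this
  have hIu : u * ∫ s in (0 : ℝ)..T, Real.exp (-(s * u)) ≤ 1 := by
    have := integral_exp_neg_mul_mul_cos (a := 0) hu T
    simp only [zero_mul, Real.cos_zero, mul_one] at this
    rw [this, ← mul_div_assoc, div_le_one (by positivity)]
    nlinarith [mul_pos (mul_pos hu hu) (Real.exp_pos (-(T * u)))]
  have hg0 := digammaKernel_nonneg hu
  have hg1 := digammaKernel_le_one hu
  have hgu := mul_digammaKernel_le_one hu
  rw [le_div_iff₀ (by positivity)]
  generalize (∫ s in (0 : ℝ)..T, Real.exp (-(s * u))) = I at *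
  generalize digammaKernel u = g at *
  have h1 : (u * g) * (u * I) ≤ 1 * 1 := by gcongr
  have h2 : g * I ≤ 1 * T := by gcongr
  linarith

lemma integrable_prod_digammaKernel {T : ℝ} (hT : 0 ≤ T) (a : ℝ) :
    Integrable (fun q : ℝ × ℝ => digammaKernel q.2 * Real.exp (-(q.1 * q.2)) * Real.cos (a * q.1))
      ((volume.restrict (Ioc 0 T)).prod (volume.restrict (Ioi 0))) := by
  have hmeas : Measurable fun q : ℝ × ℝ =>
      digammaKernel q.2 * Real.exp (-(q.1 * q.2)) * Real.cos (a * q.1) := by fun_prop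
  rw [integrable_prod_iff' hmeas.aestronglyMeasurable]
  constructor
  · refine ae_of_all _ fun u => ?_
    dsimp only
    generalize digammaKernel u = g
    exact (Continuous.integrableOn_Ioc (by fun_prop))
  · refine Integrable.mono'
      (((integrableOn_one_div_sq_add_sq one_pos).const_mul (T + 1)) :
        Integrable (fun u : ℝ => (T + 1) * (1 / (u ^ 2 + 1 ^ 2))) (volume.restrict (Ioi 0)))
      (hmeas.norm.comp measurable_swap).aestronglyMeasurable.integral_prod_right' ?_
    filter_upwards [ae_restrict_mem measurableSet_Ioi] with u hu
    have hu : 0 < u := hu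
    have hg := digammaKernel_nonneg hu
    rw [Real.norm_of_nonneg (integral_nonneg fun s => norm_nonneg _), mul_one_div]
    refine le_trans ?_ (digammaKernel_mul_integral_exp_le hu hT)
    rw [intervalIntegral.integral_of_le hT, ← MeasureTheory.integral_const_mul]
    generalize digammaKernel u = g at hg ⊢
    refine integral_mono (Continuous.integrableOn_Ioc (by fun_prop))
      (Continuous.integrableOn_Ioc (by fun_prop)) fun s => ?_
    simp only [norm_mul, Real.norm_of_nonneg hg, Real.norm_of_nonneg (Real.exp_pos _).le]
    exact mul_le_of_le_one_right (by positivity) (Real.abs_cos_le_one _)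

lemma intervalIntegral_digamma_mul_cos {T : ℝ} (hT : 0 ≤ T) (a : ℝ) :
    ∫ s in (0 : ℝ)..T, (digamma (s + 1) - Real.log s) * Real.cos (a * s) =
      ∫ u in Ioi (0 : ℝ), digammaKernel u *
        ((u + Real.exp (-(T * u)) * (a * Real.sin (a * T) - u * Real.cos (a * T))) /
          (u ^ 2 + a ^ 2)) := by
  calc ∫ s in (0 : ℝ)..T, (digamma (s + 1) - Real.log s) * Real.cos (a * s)
    _ = ∫ s in Ioc 0 T, ∫ u in Ioi (0 : ℝ),
          digammaKernel u * Real.exp (-(s * u)) * Real.cos (a * s) := by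
      rw [intervalIntegral.integral_of_le hT]
      refine setIntegral_congr_fun measurableSet_Ioc fun s hs => ?_
      simp only [MeasureTheory.integral_mul_const]
      rw [integral_digammaKernel_mul_exp hs.1]
    _ = ∫ u in Ioi (0 : ℝ), ∫ s in Ioc 0 T,
          digammaKernel u * Real.exp (-(s * u)) * Real.cos (a * s) :=
      integral_integral_swap (integrable_prod_digammaKernel hT a)
    _ = _ := by
      refine setIntegral_congr_fun measurableSet_Ioi fun u hu => ?_
      simp only [mul_assoc]
      rw [MeasureTheory.integral_const_mul, ← intervalIntegral.integral_of_le hT,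
        integral_exp_neg_mul_mul_cos hu]

lemma tendsto_integral_digammaKernel {a : ℝ} (ha : 0 < a) :
    Tendsto (fun T : ℝ => ∫ u in Ioi (0 : ℝ), digammaKernel u *
        ((u + Real.exp (-(T * u)) * (a * Real.sin (a * T) - u * Real.cos (a * T))) /
          (u ^ 2 + a ^ 2))) atTop
      (𝓝 (∫ u in Ioi (0 : ℝ), digammaKernel u * (u / (u ^ 2 + a ^ 2)))) := by
  have hbd (T u : ℝ) (hu : 0 < u) :
      |a * Real.sin (a * T) - u * Real.cos (a * T)| ≤ a + u := by
    have h1 := abs_le.mp (Real.abs_sin_le_one (a * T))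
    have h2 := abs_le.mp (Real.abs_cos_le_one (a * T))
    rw [abs_le]
    constructor <;> nlinarith
  refine tendsto_integral_filter_of_dominated_convergence
    (fun u => (a + 2) * (1 / (u ^ 2 + a ^ 2))) (Eventually.of_forall fun T => ?_) ?_
    ((integrableOn_one_div_sq_add_sq ha).const_mul _) ?_
  · exact Measurable.aestronglyMeasurable (by fun_prop)
  · filter_upwards [eventually_ge_atTop 0] with T hT
    filter_upwards [ae_restrict_mem measurableSet_Ioi] with u hu
    have hu : 0 < u := hu
    have hE : Real.exp (-(T * u)) ≤ 1 := by
      rw [Real.exp_le_one_iff]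
      linarith [mul_nonneg hT hu.le]
    have hnum : |u + Real.exp (-(T * u)) * (a * Real.sin (a * T) - u * Real.cos (a * T))| ≤
        a + 2 * u := by
      calc _ ≤ |u| + |Real.exp (-(T * u)) * (a * Real.sin (a * T) - u * Real.cos (a * T))| :=
            abs_add_le _ _
        _ ≤ u + 1 * (a + u) := by
            rw [abs_of_pos hu, abs_mul, abs_of_pos (Real.exp_pos _)]
            gcongr
            exact hbd T u hu
        _ = a + 2 * u := by ring
    rw [norm_mul, norm_div, Real.norm_of_nonneg (digammaKernel_nonneg hu), Real.norm_eq_abs,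
      Real.norm_of_nonneg (show 0 ≤ u ^ 2 + a ^ 2 by positivity), ← mul_div_assoc, mul_one_div]
    gcongr
    calc _ ≤ digammaKernel u * (a + 2 * u) :=
          mul_le_mul_of_nonneg_left hnum (digammaKernel_nonneg hu)
      _ ≤ a + 2 := by
          linarith [mul_digammaKernel_le_one hu,
            mul_le_of_le_one_left ha.le (digammaKernel_le_one hu)]
  · filter_upwards [ae_restrict_mem measurableSet_Ioi] with u hu
    have hu : 0 < u := hu
    have hz : Tendsto (fun T : ℝ => Real.exp (-(T * u)) *
        (a * Real.sin (a * T) - u * Real.cos (a * T))) atTop (𝓝 0) := by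
      refine Tendsto.zero_mul_isBoundedUnder_le ?_ ?_
      · exact Real.tendsto_exp_neg_atTop_nhds_zero.comp (tendsto_id.atTop_mul_const hu)
      · exact isBoundedUnder_of ⟨a + u, fun T => hbd T u hu⟩
    simpa using ((hz.const_add u).div_const (u ^ 2 + a ^ 2)).const_mul (digammaKernel u)

lemma tendsto_cosine_transform_digamma {y : ℝ} (hy : 0 < y) :
    Tendsto (fun T : ℝ =>
        2 * ∫ s in (0 : ℝ)..T, (digamma (s + 1) - Real.log s) * Real.cos (2 * π * y * s))
      atTop (𝓝 (digamma (y + 1) - Real.log y)) := by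
  rw [← integral_digammaKernel_mul_div hy]
  refine ((tendsto_integral_digammaKernel (a := 2 * π * y) (by positivity)).const_mul 2).congr' ?_
  filter_upwards [eventually_ge_atTop 0] with T hT
  rw [intervalIntegral_digamma_mul_cos hT]

theorem cosine_transform_digamma (z x : ℝ) (hz : 0 < z) (hx : 0 < x) :
    Tendsto (fun T : ℝ =>
        2 * ∫ t in (0 : ℝ)..T,
          (digamma (t * z + 1) - Real.log (t * z)) * Real.cos (2 * π * x * t))
      atTop (nhds ((1 / z) * (digamma (x / z + 1) - Real.log (x / z)))) := by
  have h := ((tendsto_cosine_transform_digamma (div_pos hx hz)).comp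
    (tendsto_id.atTop_mul_const hz)).const_mul (1 / z)
  refine h.congr fun T => ?_
  have hcos (t : ℝ) : 2 * π * x * t = 2 * π * (x / z) * (t * z) := by field_simp
  simp_rw [hcos]
  have := intervalIntegral.integral_comp_mul_right (a := 0) (b := T)
    (fun s => (digamma (s + 1) - Real.log s) * Real.cos (2 * π * (x / z) * s)) hz.ne'
  rw [this]
  simp only [Function.comp, id, zero_mul, smul_eq_mul]
  ring
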